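/- Let H be a Hamming code of length n and λ: H → ZMod 2 with λ(0^n) = 0 a nonlinear function (i.e., there exist y_1, y_2 ∈ H with λ(y_1 + y_2) ≠ λ(y_1) + λ(y_2)). Then for y' ∈ H, the codeword (y', λ(y'), 0^n) belongs to Tr(V_H^λ) if and only if there exist π ∈ Sym(H) and u ∈ F^n such that for every y ∈ H, λ(y') + λ(y) + λ(y' + π(y)) = u·y. -/

import Mathlib

set_option linter.unusedSectionVars false

/-- Binary vectors of length `|ι|`, indexed by `ι`. -/
abbrev F (ι : Type*) : Type _ := ι → ZMod 2

section Defs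

variable {ι : Type*}

/-- The support of a vector: the set of its nonzero coordinate positions. -/
def supp (x : F ι) : Set ι := {i | x i ≠ 0}

/-- Action of a permutation on binary vectors by permuting coordinates:
`(permAct π x) (π i) = x i`. -/
def permAct (π : Equiv.Perm ι) (x : F ι) : F ι := x ∘ π.symm

/-- The image `π(C)` of a code under a coordinate permutation. -/
def permCode (π : Equiv.Perm ι) (C : Set (F ι)) : Set (F ι) := permAct π '' C

/-- The translateCode `y + C` of a code. -/
def translateCode (y : F ι) (C : Set (F ι)) : Set (F ι) := (y + ·) '' C

/-- `Sym(C) = {π : π(C) = C}`. -/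
def SymSet (C : Set (F ι)) : Set (Equiv.Perm ι) := {π | permCode π C = C}

/-- `Rot(C) = {π : ∃ y ∈ C, y + π(C) = C}`. -/
def RotSet (C : Set (F ι)) : Set (Equiv.Perm ι) :=
  {π | ∃ y ∈ C, translateCode y (permCode π C) = C}

/-- `Rot_y(C) = {π : y + π(C) = C}`. -/
def RotAt (C : Set (F ι)) (y : F ι) : Set (Equiv.Perm ι) :=
  {π | translateCode y (permCode π C) = C}

/-- `Tr(C) = {y ∈ C : ∃ π, y + π(C) = C}`. -/
def TrSet (C : Set (F ι)) : Set (F ι) :=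
  {y | y ∈ C ∧ ∃ π : Equiv.Perm ι, translateCode y (permCode π C) = C}

/-- `Ker(C) = {x ∈ C : x + C = C}`. -/
def KerSet (C : Set (F ι)) : Set (F ι) := {x | x ∈ C ∧ translateCode x C = C}

/-- `Aut(C) = {(y, π) : y + π(C) = C}`. -/
def AutSet (C : Set (F ι)) : Set (F ι × Equiv.Perm ι) :=
  {p | translateCode p.1 (permCode p.2 C) = C}

/-- A (reduced) code is transitive if for every codeword `y` there is a permutation `π`
with `y + π(C) = C`. -/
def IsTransitive (C : Set (F ι)) : Prop :=
  ∀ y ∈ C, ∃ π : Equiv.Perm ι, translateCode y (permCode π C) = C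

/-- A code is propelinear if `Aut(C)` contains a subgroup acting regularly on `C`
(the group law is `(y, π) * (y', π') = (y + π(y'), π ∘ π')`, acting by `(y,π) • x = y + π(x)`). -/
def IsPropelinear (C : Set (F ι)) : Prop :=
  ∃ A : Set (F ι × Equiv.Perm ι),
    (∀ a ∈ A, translateCode a.1 (permCode a.2 C) = C) ∧
    ((0, 1) ∈ A) ∧
    (∀ a ∈ A, ∀ b ∈ A, (a.1 + permAct a.2 b.1, a.2 * b.2) ∈ A) ∧
    (∀ a ∈ A, (permAct a.2⁻¹ a.1, a.2⁻¹) ∈ A) ∧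
    (∀ c ∈ C, ∀ c' ∈ C, ∃! a, a ∈ A ∧ a.1 + permAct a.2 c = c')

variable [Fintype ι] [DecidableEq ι]

/-- A perfect (1-error-correcting) code: every vector is within Hamming distance 1 of
exactly one codeword. -/
def IsPerfect (C : Set (F ι)) : Prop :=
  ∀ x : F ι, ∃! c, c ∈ C ∧ hammingDist x c ≤ 1

/-- `STS(C, y) = {supp (x + y) : x ∈ C, d(x, y) = 3}`. -/
def STS (C : Set (F ι)) (y : F ι) : Set (Set ι) :=
  {s | ∃ x ∈ C, hammingDist x y = 3 ∧ s = supp (x + y)}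

/-- A reduced perfect code is homogeneous if each `STS(C,y)`, `y ∈ C`, is isomorphic
to `STS(C, 0)`. -/
def IsHomogeneous (C : Set (F ι)) : Prop :=
  ∀ y ∈ C, ∃ π : Equiv.Perm ι, (Set.image π) '' (STS C y) = STS C (0 : F ι)

/-- The (mod 2) weight `|x| = x_1 + ⋯ + x_n`. -/
def wt (x : F ι) : ZMod 2 := ∑ i, x i

/-- The scalar product `u · y = Σ u_i y_i (mod 2)`. -/
def dot (u y : F ι) : ZMod 2 := ∑ i, u i * y i

/-- A linear code: a subspace of `F ι` (over `ZMod 2` it suffices to be closed under `+`). -/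
def IsLinearCode (C : Set (F ι)) : Prop :=
  (0 : F ι) ∈ C ∧ ∀ x ∈ C, ∀ y ∈ C, x + y ∈ C

/-- A Hamming code: a linear perfect code. -/
def IsHammingCode (C : Set (F ι)) : Prop := IsLinearCode C ∧ IsPerfect C

/-- The `i`-component `R_i`: the linear span of the weight-3 codewords of `H` whose
support contains `i`. -/
def component (H : Set (F ι)) (i : ι) : Set (F ι) :=
  ↑(Submodule.span (ZMod 2) {x | x ∈ H ∧ hammingNorm x = 3 ∧ x i ≠ 0})

/-- `lam` pierces `R` if it takes both values 0 and 1 on `R`. -/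
def Pierces (lam : F ι → ZMod 2) (R : Set (F ι)) : Prop :=
  (∃ x ∈ R, lam x = 0) ∧ (∃ x ∈ R, lam x = 1)

/-- The vector `(a, b, c)` of length `2n+1`: coordinates `1..n` are `a`, coordinate `n+1`
is `b`, coordinates `n+2..2n+1` are `c`. -/
def vasVec (a : F ι) (b : ZMod 2) (c : F ι) : F (ι ⊕ Unit ⊕ ι) :=
  Sum.elim a (Sum.elim (fun _ => b) c)

/-- The Vasil'ev code `V_C^λ = {(x + y, |x| + λ(y), x) : x ∈ F^n, y ∈ C}`. -/
def Vasiliev (C : Set (F ι)) (lam : F ι → ZMod 2) : Set (F (ι ⊕ Unit ⊕ ι)) :=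
  {v | ∃ x : F ι, ∃ y ∈ C, v = vasVec (x + y) (wt x + lam y) x}

/-- The subspace `R_{n+1}^{2n+1} = {(x, |x|, x) : x ∈ F^n}`. -/
def Rmid : Set (F (ι ⊕ Unit ⊕ ι)) := {v | ∃ x : F ι, v = vasVec x (wt x) x}

/-- Underlying function of `τ_u`: swaps positions `i` and `i + n + 1` for `i ∈ supp u`. -/
def tauFun (u : F ι) : (ι ⊕ Unit ⊕ ι) → (ι ⊕ Unit ⊕ ι)
  | Sum.inl i => if u i ≠ 0 then Sum.inr (Sum.inr i) else Sum.inl i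
  | Sum.inr (Sum.inl _) => Sum.inr (Sum.inl ())
  | Sum.inr (Sum.inr i) => if u i ≠ 0 then Sum.inl i else Sum.inr (Sum.inr i)

theorem tauFun_involutive (u : F ι) : Function.Involutive (tauFun u) := by
  intro x
  rcases x with i | x
  · by_cases h : u i = 0 <;> simp [tauFun, h]
  · rcases x with u' | i
    · simp [tauFun]
    · by_cases h : u i = 0 <;> simp [tauFun, h]

/-- The permutation `τ_u`: the product of transpositions `(i, i+n+1)` over `i ∈ supp u`. -/
def tau (u : F ι) : Equiv.Perm (ι ⊕ Unit ⊕ ι) :=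
  Function.Involutive.toPerm (tauFun u) (tauFun_involutive u)

/-- The duplicator `σ_π`: fixes position `n+1`, sends `i ↦ π(i)` and `i+n+1 ↦ π(i)+n+1`. -/
def dup (π : Equiv.Perm ι) : Equiv.Perm (ι ⊕ Unit ⊕ ι) :=
  Equiv.sumCongr π (Equiv.sumCongr (Equiv.refl Unit) π)

/-- The extension of `λ` one step up the Vasil'ev recursion: `λ'(z) = λ(y)` for
`z ∈ (y, 0^{m+1}) + R_{m+1}^{2m+1}` (well defined by recovering `y` from `z`). -/
def lamSucc (lam : F ι → ZMod 2) : F (ι ⊕ Unit ⊕ ι) → ZMod 2 :=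
  fun z => lam (fun i => z (Sum.inl i) + z (Sum.inr (Sum.inr i)))

/-- `T = {y' ∈ H : (y', λ(y'), 0) ∈ Tr(V_H^λ)}`. -/
def Tset (H : Set (F ι)) (lam : F ι → ZMod 2) : Set (F ι) :=
  {y' | y' ∈ H ∧ vasVec y' (lam y') 0 ∈ TrSet (Vasiliev H lam)}

/-- The Assmus–Mattson Steiner triple system `S^θ` of order `2n+1`. -/
def AM (S : Set (Set ι)) (θ : Set ι → ZMod 2) : Set (Set (ι ⊕ Unit ⊕ ι)) :=
  {T | (∃ i : ι, T = {Sum.inl i, Sum.inr (Sum.inl ()), Sum.inr (Sum.inr i)}) ∨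
    (∃ s ∈ S, θ s = 0 ∧
      (T = Sum.inl '' s ∨
        ∃ a ∈ s, T = insert (Sum.inl a) ((fun i => Sum.inr (Sum.inr i)) '' (s \ {a})))) ∨
    (∃ s ∈ S, θ s = 1 ∧
      (T = (fun i => Sum.inr (Sum.inr i)) '' s ∨
        ∃ a ∈ s, T = insert (Sum.inr (Sum.inr a)) (Sum.inl '' (s \ {a}))))}

end Defs

/-- A Steiner triple system on the point set `α`. -/
def IsSTS {α : Type*} (S : Set (Set α)) : Prop :=
  (∀ s ∈ S, s.ncard = 3) ∧ ∀ i j : α, i ≠ j → ∃! s, s ∈ S ∧ i ∈ s ∧ j ∈ s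

/-- The Mollard code (with zero function) of the codes `C` and `D`. -/
def Mollard {t r : Type*} [Fintype t] [Fintype r] (C : Set (F t)) (D : Set (F r)) :
    Set (F ((t × r) ⊕ t ⊕ r)) :=
  {v | ∃ x : F (t × r), ∃ c ∈ C, ∃ d ∈ D,
    v = Sum.elim x (Sum.elim (fun i => c i + ∑ j, x (i, j)) (fun j => d j + ∑ i, x (i, j)))}

/-- Index types of the iterated Vasil'ev construction: lengths `n`, `2n+1`, `4n+3`, …. -/
def HType (n : ℕ) : ℕ → Type
  | 0 => Fin n
  | s + 1 => HType n s ⊕ Unit ⊕ HType n s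

def HType.ft (n : ℕ) : ∀ s, Fintype (HType n s)
  | 0 => inferInstanceAs (Fintype (Fin n))
  | s + 1 =>
      letI := HType.ft n s
      inferInstanceAs (Fintype (HType n s ⊕ Unit ⊕ HType n s))

instance (n s : ℕ) : Fintype (HType n s) := HType.ft n s

def HType.deq (n : ℕ) : ∀ s, DecidableEq (HType n s)
  | 0 => inferInstanceAs (DecidableEq (Fin n))
  | s + 1 =>
      letI := HType.deq n s
      inferInstanceAs (DecidableEq (HType n s ⊕ Unit ⊕ HType n s))

instance (n s : ℕ) : DecidableEq (HType n s) := HType.deq n s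

/-- The iterated Hamming codes `H^n, H^{2n+1} = V_{H^n}^0, H^{4n+3}, …`. -/
def Hcode (n : ℕ) (H : Set (F (Fin n))) : ∀ s, Set (F (HType n s))
  | 0 => H
  | s + 1 => Vasiliev (Hcode n H s) 0

/-- The iterated functions `λ_n = λ`, `λ_{2m+1}` extending `λ_m`. -/
def lamIter (n : ℕ) (lam : F (Fin n) → ZMod 2) : ∀ s, F (HType n s) → ZMod 2
  | 0 => lam
  | s + 1 => lamSucc (lamIter n lam s)

/-- `C_0 = V_{H^n}^λ`, `C_{s+1} = V_{C_s}^0`. -/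
def Ccode (n : ℕ) (H : Set (F (Fin n))) (lam : F (Fin n) → ZMod 2) :
    ∀ s, Set (F (HType n (s + 1)))
  | 0 => Vasiliev H lam
  | s + 1 => Vasiliev (Ccode n H lam s) 0

section VasilievTransitivity

variable {ι : Type*}

theorem binary_add_self (x : F ι) : x + x = 0 :=
  funext fun i => CharTwo.add_self_eq_zero (x i)

theorem permAct_injective (π : Equiv.Perm ι) : Function.Injective (permAct π) := by
  intro x y h
  funext i
  simpa [permAct] using congrFun h (π i)

theorem permAct_add (π : Equiv.Perm ι) (x y : F ι) :
    permAct π (x + y) = permAct π x + permAct π y := rfl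

theorem permAct_single [DecidableEq ι] (π : Equiv.Perm ι) (i : ι) :
    permAct π (Pi.single i 1) = Pi.single (π i) 1 := by
  funext j
  simp [permAct, Pi.single_apply, Equiv.symm_apply_eq]

variable [Fintype ι] [DecidableEq ι]

theorem image_eq_of_injective_of_mapsTo {α : Type*} [Finite α] {f : α → α} {C : Set α}
    (hf : Function.Injective f) (h : Set.MapsTo f C C) : f '' C = C :=
  Set.eq_of_subset_of_ncard_le h.image_subset (Set.ncard_image_of_injective C hf).ge

theorem hammingDist_add_single_le (x : F ι) (i : ι) :
    hammingDist x (x + Pi.single i 1) ≤ 1 := by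
  unfold hammingDist
  refine Finset.card_le_one.2 fun a ha b hb => ?_
  have key : ∀ c, x c ≠ (x + Pi.single i 1 : F ι) c → c = i := by
    intro c hc
    by_contra hci
    simp [hci] at hc
  rw [key a (by simpa using ha), key b (by simpa using hb)]

theorem IsHammingCode.single_notMem {H : Set (F ι)} (hH : IsHammingCode H) (i : ι) :
    Pi.single i 1 ∉ H := by
  intro h
  have h1 := hammingDist_add_single_le (0 : F ι) i
  rw [zero_add] at h1
  have := (hH.2 0).unique ⟨h, h1⟩ ⟨hH.1.1, by simp⟩
  simpa using congrFun this i

theorem IsHammingCode.eq_of_single_add_single_mem {H : Set (F ι)} (hH : IsHammingCode H)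
    {i j : ι} (h : Pi.single i 1 + Pi.single j 1 ∈ H) : i = j := by
  have h0 := hammingDist_add_single_le (0 : F ι) i
  rw [zero_add, hammingDist_comm] at h0
  have := (hH.2 (Pi.single i 1)).unique ⟨h, hammingDist_add_single_le _ j⟩ ⟨hH.1.1, h0⟩
  by_contra hij
  simpa [hij] using congrFun this i

/-- The sum of the two outer blocks of a vector of length `2n+1`. -/
def outerSum (v : F (ι ⊕ Unit ⊕ ι)) : F ι :=
  fun i => v (Sum.inl i) + v (Sum.inr (Sum.inr i))

theorem outerSum_add (v w : F (ι ⊕ Unit ⊕ ι)) :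
    outerSum (v + w) = outerSum v + outerSum w := by
  funext i
  simp only [outerSum, Pi.add_apply]
  ring

theorem outerSum_vasVec (a : F ι) (b : ZMod 2) (c : F ι) :
    outerSum (vasVec a b c) = a + c := rfl

theorem outerSum_single_inl (i : ι) :
    outerSum (Pi.single (Sum.inl i) 1) = Pi.single i 1 := by
  funext j
  simp [outerSum, Pi.single_apply]

theorem outerSum_single_inr (i : ι) :
    outerSum (Pi.single (Sum.inr (Sum.inr i)) 1) = Pi.single i 1 := by
  funext j
  simp [outerSum, Pi.single_apply]

theorem mem_vasiliev_iff {C : Set (F ι)} {lam : F ι → ZMod 2} {v : F (ι ⊕ Unit ⊕ ι)} :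
    v ∈ Vasiliev C lam ↔ outerSum v ∈ C ∧
      v (Sum.inr (Sum.inl ())) = wt (fun i => v (Sum.inr (Sum.inr i))) + lam (outerSum v) := by
  constructor
  · rintro ⟨x, y, hy, rfl⟩
    have : outerSum (vasVec (x + y) (wt x + lam y) x) = y := by
      rw [outerSum_vasVec, add_right_comm, binary_add_self, zero_add]
    rw [this]
    exact ⟨hy, rfl⟩
  · rintro ⟨hv, hmid⟩
    refine ⟨fun i => v (Sum.inr (Sum.inr i)), _, hv, ?_⟩
    funext k
    rcases k with i | u | i
    · simp only [vasVec, outerSum, Sum.elim_inl, Pi.add_apply]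
      rw [add_left_comm, CharTwo.add_self_eq_zero, add_zero]
    · exact hmid
    · rfl

theorem vasVec_zero_mem_vasiliev {C : Set (F ι)} (lam : F ι → ZMod 2) {y : F ι} (hy : y ∈ C) :
    vasVec y (lam y) 0 ∈ Vasiliev C lam :=
  ⟨0, y, hy, by simp [wt]⟩

/-- Up to a swap within each pair, `P` acts on the pairs `{i, i+n+1}` as `φ`. -/
theorem exists_pair_perm {H : Set (F ι)} (hH : IsHammingCode H) (P : Equiv.Perm (ι ⊕ Unit ⊕ ι))
    (hmid : outerSum (Pi.single (P (Sum.inr (Sum.inl ()))) 1) ∈ H)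
    (hpair : ∀ i, outerSum (Pi.single (P (Sum.inl i)) 1 +
      Pi.single (P (Sum.inr (Sum.inr i))) 1) ∈ H) :
    P (Sum.inr (Sum.inl ())) = Sum.inr (Sum.inl ()) ∧ ∃ φ : Equiv.Perm ι, ∀ i,
      (P (Sum.inl i) = Sum.inl (φ i) ∧ P (Sum.inr (Sum.inr i)) = Sum.inr (Sum.inr (φ i))) ∨
      (P (Sum.inl i) = Sum.inr (Sum.inr (φ i)) ∧ P (Sum.inr (Sum.inr i)) = Sum.inl (φ i)) := by
  have hm : P (Sum.inr (Sum.inl ())) = Sum.inr (Sum.inl ()) := by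
    rcases h : P (Sum.inr (Sum.inl ())) with j | ⟨⟩ | j
    · rw [h, outerSum_single_inl] at hmid
      exact absurd hmid (hH.single_notMem j)
    · rfl
    · rw [h, outerSum_single_inr] at hmid
      exact absurd hmid (hH.single_notMem j)
  have hex : ∀ i, ∃ j,
      (P (Sum.inl i) = Sum.inl j ∧ P (Sum.inr (Sum.inr i)) = Sum.inr (Sum.inr j)) ∨
      (P (Sum.inl i) = Sum.inr (Sum.inr j) ∧ P (Sum.inr (Sum.inr i)) = Sum.inl j) := by
    intro i
    have hne : P (Sum.inl i) ≠ P (Sum.inr (Sum.inr i)) := by simp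
    have hl : P (Sum.inl i) ≠ Sum.inr (Sum.inl ()) := by rw [← hm]; simp
    have hr : P (Sum.inr (Sum.inr i)) ≠ Sum.inr (Sum.inl ()) := by rw [← hm]; simp
    have hp := hpair i
    rw [outerSum_add] at hp
    rcases h1 : P (Sum.inl i) with j | ⟨⟩ | j <;>
      rcases h2 : P (Sum.inr (Sum.inr i)) with k | ⟨⟩ | k <;>
      simp only [h1, h2, outerSum_single_inl, outerSum_single_inr, ne_eq, not_true_eq_false]
        at hp hne hl hr
    all_goals
      obtain rfl := hH.eq_of_single_add_single_mem hp
      simp at hne ⊢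
  choose φ hφ using hex
  have hinj : Function.Injective φ := by
    intro i j hij
    have hi := hφ i
    have hj := hφ j
    rw [hij] at hi
    have aux : ∀ a b, P a = P b → a = b := fun a b h => P.injective h
    rcases hi with ⟨h1, h2⟩ | ⟨h1, h2⟩ <;> rcases hj with ⟨h3, h4⟩ | ⟨h3, h4⟩
    · simpa using aux _ _ (h1.trans h3.symm)
    · simpa using aux _ _ (h1.trans h4.symm)
    · simpa using aux _ _ (h1.trans h4.symm)
    · simpa using aux _ _ (h1.trans h3.symm)
  exact ⟨hm, Equiv.ofBijective φ (Finite.injective_iff_bijective.1 hinj), hφ⟩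

theorem exists_sym_of_vasVec_mem_trSet {H : Set (F ι)} (hH : IsHammingCode H)
    {lam : F ι → ZMod 2}
    (hnl : ∃ y₁ ∈ H, ∃ y₂ ∈ H, lam (y₁ + y₂) ≠ lam y₁ + lam y₂) {y' : F ι} (hy' : y' ∈ H)
    (h : vasVec y' (lam y') 0 ∈ TrSet (Vasiliev H lam)) :
    ∃ π ∈ SymSet H, ∃ u : F ι,
      ∀ y ∈ H, lam y' + lam y + lam (y' + permAct π y) = dot u y := by
  obtain ⟨-, P, hP⟩ := h
  have hV : ∀ v ∈ Vasiliev H lam, vasVec y' (lam y') 0 + permAct P v ∈ Vasiliev H lam := by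
    intro v hv
    have hmem : vasVec y' (lam y') 0 + permAct P v ∈
        translateCode (vasVec y' (lam y') 0) (permCode P (Vasiliev H lam)) :=
      ⟨_, ⟨v, hv, rfl⟩, rfl⟩
    rwa [hP] at hmem
  have hout : ∀ v ∈ Vasiliev H lam, outerSum (permAct P v) ∈ H := by
    intro v hv
    have h1 := hH.1.2 _ hy' _ (mem_vasiliev_iff.1 (hV v hv)).1
    rwa [outerSum_add, outerSum_vasVec, add_zero, ← add_assoc, binary_add_self, zero_add] at h1
  have hmid : outerSum (permAct P (Pi.single (Sum.inr (Sum.inl ())) 1)) ∈ H := by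
    obtain ⟨y₁, h₁, y₂, h₂, hne⟩ := hnl
    have hsum : (Pi.single (Sum.inr (Sum.inl ())) 1 : F (ι ⊕ Unit ⊕ ι)) =
        vasVec y₁ (lam y₁) 0 + vasVec y₂ (lam y₂) 0 + vasVec (y₁ + y₂) (lam (y₁ + y₂)) 0 := by
      funext k
      rcases k with i | ⟨⟩ | i
      · have := congrFun (binary_add_self (y₁ + y₂)) i
        simpa [vasVec] using this.symm
      · have : ∀ a b c : ZMod 2, c ≠ a + b → 1 = a + b + c := by decide
        simpa [vasVec] using this _ _ _ hne
      · simp [vasVec]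
    rw [hsum, permAct_add, permAct_add, outerSum_add, outerSum_add]
    exact hH.1.2 _ (hH.1.2 _ (hout _ (vasVec_zero_mem_vasiliev lam h₁)) _
      (hout _ (vasVec_zero_mem_vasiliev lam h₂))) _
      (hout _ (vasVec_zero_mem_vasiliev lam (hH.1.2 _ h₁ _ h₂)))
  have hpair : ∀ i, outerSum (Pi.single (P (Sum.inl i)) 1 +
      Pi.single (P (Sum.inr (Sum.inr i))) 1) ∈ H := by
    intro i
    rw [← permAct_single, ← permAct_single, ← permAct_add]
    have hsum : (Pi.single (Sum.inl i) 1 + Pi.single (Sum.inr (Sum.inr i)) 1 :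
        F (ι ⊕ Unit ⊕ ι)) = vasVec (Pi.single i 1 + 0) (wt (Pi.single i 1) + lam 0)
          (Pi.single i 1) + (vasVec 0 (lam 0) 0 +
          Pi.single (Sum.inr (Sum.inl ())) 1) := by
      have h2 : ∀ a : ZMod 2, 0 = 1 + a + (a + 1) := by decide
      funext k
      rcases k with j | ⟨⟩ | j
      · simp [vasVec, Pi.single_apply]
      · simpa [vasVec, wt] using h2 (lam 0)
      · simp [vasVec, Pi.single_apply]
    rw [hsum, permAct_add, outerSum_add, permAct_add, outerSum_add]
    exact hH.1.2 _ (hout _ ⟨_, 0, hH.1.1, rfl⟩) _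
      (hH.1.2 _ (hout _ (vasVec_zero_mem_vasiliev lam hH.1.1)) _ hmid)
  rw [permAct_single] at hmid
  obtain ⟨hm, φ, hφ⟩ := exists_pair_perm hH P hmid hpair
  have hsymm : ∀ a b, P a = b → P.symm b = a := fun a b h => by rw [← h, P.symm_apply_apply]
  set u : F ι := fun i => if P (Sum.inl i) = Sum.inl (φ i) then 0 else 1 with hu
  have hl : ∀ (y : F ι) (b : ZMod 2) i,
      permAct P (vasVec y b 0) (Sum.inl (φ i)) = (1 + u i) * y i := by
    intro y b i
    rcases hφ i with ⟨h1, h2⟩ | ⟨h1, h2⟩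
    · simp [permAct, hsymm _ _ h1, hu, h1, vasVec]
    · simp [permAct, hsymm _ _ h2, hu, h1, vasVec, CharTwo.add_self_eq_zero]
  have hr : ∀ (y : F ι) (b : ZMod 2) i,
      permAct P (vasVec y b 0) (Sum.inr (Sum.inr (φ i))) = u i * y i := by
    intro y b i
    rcases hφ i with ⟨h1, h2⟩ | ⟨h1, h2⟩
    · simp [permAct, hsymm _ _ h2, hu, h1, vasVec]
    · simp [permAct, hsymm _ _ h1, hu, h1, vasVec]
  have hfold : ∀ (y : F ι) (b : ZMod 2), outerSum (permAct P (vasVec y b 0)) = permAct φ y := by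
    intro y b
    funext j
    obtain ⟨i, rfl⟩ := φ.surjective j
    have h2 : ∀ a c : ZMod 2, (1 + a) * c + a * c = c := by decide
    simp only [outerSum, hl, hr, h2]
    simp [permAct]
  refine ⟨φ, image_eq_of_injective_of_mapsTo (permAct_injective φ) fun y hy => ?_, u,
    fun y hy => ?_⟩
  · rw [← hfold y (lam y)]
    exact hout _ (vasVec_zero_mem_vasiliev lam hy)
  · have h1 := (mem_vasiliev_iff.1 (hV _ (vasVec_zero_mem_vasiliev lam hy))).2
    rw [outerSum_add, hfold, outerSum_vasVec, add_zero] at h1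
    have hw : wt (fun i => (vasVec y' (lam y') 0 + permAct P (vasVec y (lam y) 0))
        (Sum.inr (Sum.inr i))) = dot u y := by
      unfold wt dot
      rw [← Equiv.sum_comp φ]
      refine Finset.sum_congr rfl fun i _ => ?_
      rw [Pi.add_apply, hr]
      simp [vasVec]
    have hb : (vasVec y' (lam y') 0 + permAct P (vasVec y (lam y) 0)) (Sum.inr (Sum.inl ())) =
        lam y' + lam y := by
      simp [permAct, hsymm _ _ hm, vasVec]
    rw [hw, hb] at h1
    rw [h1, add_assoc, CharTwo.add_self_eq_zero, add_zero]

theorem permAct_dup_mul_tau (π : Equiv.Perm ι) (u x y : F ι) (b : ZMod 2) :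
    permAct (dup π * tau u) (vasVec (x + y) b x) =
      vasVec (permAct π (x + u * y) + permAct π y) b (permAct π (x + u * y)) := by
  have h2 : ∀ a : ZMod 2, a ≠ 0 → a = 1 := by decide
  funext k
  obtain ⟨k, rfl⟩ := (dup π).surjective k
  have hk : (dup π * tau u).symm (dup π k) = tauFun u k := by
    rw [Equiv.symm_apply_eq, Equiv.Perm.mul_apply]
    exact congrArg _ (tauFun_involutive u k).symm
  simp only [permAct, Function.comp_apply, hk]
  rcases k with i | ⟨⟩ | i
  · by_cases h : u i = 0
    · simp [tauFun, h, dup, vasVec]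
    · have hx : x i = x i + y i + y i := by
        rw [add_assoc, CharTwo.add_self_eq_zero, add_zero]
      simpa [tauFun, h2 _ h, dup, vasVec] using hx
  · simp [tauFun, dup, vasVec]
  · by_cases h : u i = 0
    · simp [tauFun, h, dup, vasVec]
    · simp [tauFun, h2 _ h, dup, vasVec]

theorem vasVec_mem_trSet_of_sym {H : Set (F ι)} (hH : IsLinearCode H) {lam : F ι → ZMod 2}
    {y' : F ι} (hy' : y' ∈ H) {π : Equiv.Perm ι} (hπ : π ∈ SymSet H) {u : F ι}
    (hu : ∀ y ∈ H, lam y' + lam y + lam (y' + permAct π y) = dot u y) :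
    vasVec y' (lam y') 0 ∈ TrSet (Vasiliev H lam) := by
  refine ⟨vasVec_zero_mem_vasiliev lam hy', dup π * tau u, ?_⟩
  rw [translateCode, permCode, Set.image_image]
  refine image_eq_of_injective_of_mapsTo
    ((add_right_injective _).comp (permAct_injective _)) ?_
  rintro _ ⟨x, y, hy, rfl⟩
  have hπy : permAct π y ∈ H := by
    rw [← show permCode π H = H from hπ]
    exact ⟨y, hy, rfl⟩
  refine ⟨permAct π (x + u * y), y' + permAct π y, hH.2 _ hy' _ hπy, ?_⟩
  have hw : wt (permAct π (x + u * y)) = wt x + dot u y := by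
    unfold wt dot
    rw [← Equiv.sum_comp π, ← Finset.sum_add_distrib]
    simp [permAct]
  have h2 : ∀ w a b c : ZMod 2, a + (w + b) = w + (a + b + c) + c := by decide
  beta_reduce
  rw [permAct_dup_mul_tau, hw, ← hu y hy, ← h2]
  funext k
  rcases k with i | ⟨⟩ | i
  · simp only [vasVec, Pi.add_apply, Sum.elim_inl]
    ring
  · rfl
  · simp [vasVec]

end VasilievTransitivity

/-- for a nonlinear `λ` on a Hamming code `H`, the codeword
`(y', λ(y'), 0^n)` lies in `Tr(V_H^λ)` iff the equation `(2)` is solvable. -/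
theorem stmt3 {n : ℕ} (H : Set (F (Fin n))) (hH : IsHammingCode H)
    (lam : F (Fin n) → ZMod 2) (hlam : lam 0 = 0)
    (hnl : ∃ y₁ ∈ H, ∃ y₂ ∈ H, lam (y₁ + y₂) ≠ lam y₁ + lam y₂)
    (y' : F (Fin n)) (hy' : y' ∈ H) :
    vasVec y' (lam y') 0 ∈ TrSet (Vasiliev H lam) ↔
      ∃ π ∈ SymSet H, ∃ u : F (Fin n),
        ∀ y ∈ H, lam y' + lam y + lam (y' + permAct π y) = dot u y := by
  exact ⟨exists_sym_of_vasVec_mem_trSet hH hnl hy', fun ⟨_, hπ, _, hu⟩ =>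
    vasVec_mem_trSet_of_sym hH.1 hy' hπ hu⟩
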